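/- Let h ∈ C^∞(R^d \ {0}) be positively homogeneous of degree κ > 0 (h(λx)=λ^κ h(x) for x ≠ 0, λ > 0), let χ ∈ C_0^∞(R^d), and set f = hχ. Then for every Schwartz window g there exists C > 0 such that |V_g f(x,ξ)| ≤ C (1+|ξ|)^{−κ−d} for all x, ξ ∈ R^d. -/

import Mathlib

open MeasureTheory Complex

noncomputable section

/-- Time-frequency shift `π(z) = T_x M_ω`. -/
def tfshift {d : ℕ} (z : (Fin d → ℝ) × (Fin d → ℝ)) (f : (Fin d → ℝ) → ℂ)
    (y : Fin d → ℝ) : ℂ :=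
  Complex.exp (Complex.I * ((∑ i, z.2 i * (y - z.1) i : ℝ) : ℂ)) * f (y - z.1)

/-- Short-time Fourier transform `V_g f(z) = ⟨f, π(z)g⟩`. -/
def stft {d : ℕ} (g f : (Fin d → ℝ) → ℂ) (z : (Fin d → ℝ) × (Fin d → ℝ)) : ℂ :=
  ∫ y, f y * starRingEnd ℂ (tfshift z g y)

/-- A function on `ι × E` that is bounded and satisfies a dyadic self-improving estimate with
gain `2 ^ (-s)`, up to an error decaying faster than `‖ξ‖ ^ (-s)`, has decay of order `s`. -/
lemma decay_of_dyadic_recursion {ι E : Type*} [NormedAddCommGroup E] [NormedSpace ℝ E]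
    (a : ι → E → ℝ) (T : ι → ι) {A C s : ℝ} {N : ℕ} (hs : 0 < s) (hsN : s < N)
    (hA : ∀ i ξ, a i ξ ≤ A)
    (hrec : ∀ i ξ, 1 ≤ ‖ξ‖ →
      a i ξ ≤ C * ‖ξ‖ ^ (-(N : ℝ)) + 2 ^ (-s) * a (T i) ((1 / 2 : ℝ) • ξ)) :
    ∃ D > 0, ∀ i ξ, a i ξ ≤ D * (1 + ‖ξ‖) ^ (-s) := by
  have hgap : 0 < (2 : ℝ) ^ ((N : ℝ) - s) - 1 :=
    sub_pos.2 (Real.one_lt_rpow one_lt_two (by linarith))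
  obtain ⟨B, hB0, hB⟩ : ∃ B : ℝ, 0 ≤ B ∧ C ≤ B * ((2 : ℝ) ^ ((N : ℝ) - s) - 1) := by
    refine ⟨|C| / ((2 : ℝ) ^ ((N : ℝ) - s) - 1), by positivity, ?_⟩
    rw [div_mul_cancel₀ _ hgap.ne']
    exact le_abs_self C
  set D : ℝ := |A| + B * 2 ^ (N : ℝ) with hD
  have hD0 : 0 ≤ D := by positivity
  have key : ∀ n : ℕ, ∀ i ξ, 1 / 2 ≤ ‖ξ‖ → ‖ξ‖ ≤ 2 ^ n →
      a i ξ ≤ D * ‖ξ‖ ^ (-s) - B * ‖ξ‖ ^ (-(N : ℝ)) := by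
    intro n
    induction n with
    | zero =>
      intro i ξ h1 h2
      have hpos : 0 < ‖ξ‖ := by linarith
      have e1 : 1 ≤ ‖ξ‖ ^ (-s) :=
        Real.one_le_rpow_of_pos_of_le_one_of_nonpos hpos (by simpa using h2) (by linarith)
      have e2 : ‖ξ‖ ^ (-(N : ℝ)) ≤ 2 ^ (N : ℝ) := by
        have := Real.rpow_le_rpow_of_nonpos (by norm_num : (0 : ℝ) < 1 / 2) h1
          (by simp : -(N : ℝ) ≤ 0)
        refine this.trans_eq ?_
        rw [one_div, Real.inv_rpow (by norm_num), Real.rpow_neg (by norm_num), inv_inv]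
      have e3 : D ≤ D * ‖ξ‖ ^ (-s) := le_mul_of_one_le_right hD0 e1
      have e4 := mul_le_mul_of_nonneg_left e2 hB0
      linarith [hA i ξ, le_abs_self A]
    | succ n ih =>
      intro i ξ h1 h2
      rcases le_or_gt ‖ξ‖ 1 with h | h
      · exact ih i ξ h1 (h.trans (one_le_pow₀ one_le_two))
      have hpos : 0 < ‖ξ‖ := by linarith
      have hnorm : ‖(1 / 2 : ℝ) • ξ‖ = ‖ξ‖ / 2 := by
        rw [norm_smul, Real.norm_of_nonneg (by norm_num)]; ring
      have h3 := ih (T i) ((1 / 2 : ℝ) • ξ) (by rw [hnorm]; linarith)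
        (by rw [hnorm]; rw [pow_succ] at h2; linarith)
      have h4 := hrec i ξ h.le
      rw [hnorm, Real.div_rpow hpos.le zero_le_two, Real.div_rpow hpos.le zero_le_two] at h3
      have h2s : (0 : ℝ) < 2 ^ (-s) := by positivity
      have h5 := mul_le_mul_of_nonneg_left h3 h2s.le
      have h6 : (2 : ℝ) ^ (-s) * (D * (‖ξ‖ ^ (-s) / 2 ^ (-s)) -
          B * (‖ξ‖ ^ (-(N : ℝ)) / 2 ^ (-(N : ℝ)))) =
          D * ‖ξ‖ ^ (-s) - B * 2 ^ ((N : ℝ) - s) * ‖ξ‖ ^ (-(N : ℝ)) := by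
        rw [sub_eq_add_neg (N : ℝ), Real.rpow_add two_pos, Real.rpow_neg zero_le_two (N : ℝ)]
        field_simp
      rw [h6] at h5
      have h7 := mul_le_mul_of_nonneg_right hB (Real.rpow_nonneg hpos.le (-(N : ℝ)))
      linarith
  refine ⟨(D + 1) * 2 ^ s, by positivity, fun i ξ ↦ ?_⟩
  have e0 : (2 : ℝ) ^ s * 2 ^ (-s) = 1 := by
    rw [← Real.rpow_add two_pos]; simp
  rcases le_or_gt ‖ξ‖ 1 with h | h
  · have e1 : (2 : ℝ) ^ (-s) ≤ (1 + ‖ξ‖) ^ (-s) :=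
      Real.rpow_le_rpow_of_nonpos (by positivity) (by linarith) (by linarith)
    have e2 : A ≤ D + 1 := by
      have : 0 ≤ B * (2 : ℝ) ^ (N : ℝ) := by positivity
      linarith [le_abs_self A]
    calc a i ξ ≤ (D + 1) * (2 ^ s * 2 ^ (-s)) := by rw [e0]; linarith [hA i ξ]
      _ = (D + 1) * 2 ^ s * 2 ^ (-s) := by ring
      _ ≤ _ := by gcongr
  · obtain ⟨n, hn⟩ := pow_unbounded_of_one_lt ‖ξ‖ one_lt_two
    have hpos : 0 < ‖ξ‖ := by linarith
    have h1 := key n i ξ (by linarith) hn.le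
    have e1 : 0 ≤ B * ‖ξ‖ ^ (-(N : ℝ)) := by positivity
    have e2 : (2 * ‖ξ‖) ^ (-s) ≤ (1 + ‖ξ‖) ^ (-s) :=
      Real.rpow_le_rpow_of_nonpos (by positivity) (by linarith) (by linarith)
    have e3 : 0 ≤ ‖ξ‖ ^ (-s) := by positivity
    calc a i ξ ≤ (D + 1) * ((2 ^ s * 2 ^ (-s)) * ‖ξ‖ ^ (-s)) := by rw [e0]; linarith
      _ = (D + 1) * 2 ^ s * (2 * ‖ξ‖) ^ (-s) := by
        rw [Real.mul_rpow zero_le_two hpos.le]; ring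
      _ ≤ _ := by gcongr

/-- The oscillatory integral `∫ u(y) e^{-i ξ·y} dy`. -/
def oscInt {d : ℕ} (u : (Fin d → ℝ) → ℂ) (ξ : Fin d → ℝ) : ℂ :=
  ∫ y, Complex.exp (-(Complex.I * ((∑ i, ξ i * y i : ℝ) : ℂ))) * u y

lemma norm_exp_neg_I_mul (t : ℝ) : ‖Complex.exp (-(Complex.I * (t : ℂ)))‖ = 1 := by
  rw [Complex.norm_exp]; simp

lemma norm_oscInt_le {d : ℕ} (u : (Fin d → ℝ) → ℂ) (ξ : Fin d → ℝ) :
    ‖oscInt u ξ‖ ≤ ∫ y, ‖u y‖ := by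
  refine (norm_integral_le_integral_norm _).trans_eq ?_
  simp only [norm_mul, norm_exp_neg_I_mul, one_mul]

/-- The dot product as a continuous bilinear map. -/
def dotCLM (d : ℕ) : (Fin d → ℝ) →L[ℝ] (Fin d → ℝ) →L[ℝ] ℝ :=
  ∑ i, (ContinuousLinearMap.mul ℝ ℝ).bilinearComp (ContinuousLinearMap.proj i)
    (ContinuousLinearMap.proj i)

lemma dotCLM_apply {d : ℕ} (v w : Fin d → ℝ) : dotCLM d v w = ∑ i, v i * w i := by
  simp [dotCLM]

lemma oscInt_eq_fourierIntegral {d : ℕ} (u : (Fin d → ℝ) → ℂ) (ξ : Fin d → ℝ) :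
    oscInt u ξ = VectorFourier.fourierIntegral Real.fourierChar volume
      (dotCLM d).toLinearMap₁₂ u ((2 * Real.pi)⁻¹ • ξ) := by
  unfold oscInt VectorFourier.fourierIntegral
  congr 1 with y
  rw [Circle.smul_def, Real.fourierChar_apply, smul_eq_mul]
  congr 2
  have : (dotCLM d).toLinearMap₁₂ y ((2 * Real.pi)⁻¹ • ξ) =
      (2 * Real.pi)⁻¹ * ∑ i, ξ i * y i := by
    change dotCLM d y _ = _
    rw [dotCLM_apply, Finset.mul_sum]
    refine Finset.sum_congr rfl fun i _ ↦ ?_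
    simp only [Pi.smul_apply, smul_eq_mul]; ring
  rw [this]
  push_cast
  have : (Real.pi : ℂ) ≠ 0 := by exact_mod_cast Real.pi_ne_zero
  field_simp

lemma pow_mul_norm_oscInt_le {d : ℕ} {u : (Fin d → ℝ) → ℂ} (hu : ContDiff ℝ (⊤ : ℕ∞) u)
    (hsupp : HasCompactSupport u) (n : ℕ) (ξ : Fin d → ℝ) :
    ‖ξ‖ ^ n * ‖oscInt u ξ‖ ≤
      (4 * Real.pi) ^ n * ∑ p ∈ Finset.range (n + 1), ∫ v, ‖iteratedFDeriv ℝ p u v‖ := by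
  have hint : ∀ p : ℕ, Integrable (fun v ↦ ‖iteratedFDeriv ℝ p u v‖) := fun p ↦
    ((hu.continuous_iteratedFDeriv (by exact_mod_cast le_top)).integrable_of_hasCompactSupport
      (hsupp.iteratedFDeriv p)).norm
  have hsum : 0 ≤ ∑ p ∈ Finset.range (n + 1), ∫ v, ‖iteratedFDeriv ℝ p u v‖ :=
    Finset.sum_nonneg fun p _ ↦ integral_nonneg fun v ↦ norm_nonneg _
  rcases isEmpty_or_nonempty (Fin d) with hd | hd
  · have hξ : ξ = 0 := Subsingleton.elim _ _
    rcases Nat.eq_zero_or_pos n with rfl | hn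
    · simpa using norm_oscInt_le u ξ
    · rw [hξ, norm_zero, zero_pow hn.ne', zero_mul]
      positivity
  obtain ⟨i, hi⟩ : ∃ i, ‖ξ‖ = |ξ i| := by
    obtain ⟨i, hi⟩ := Finite.exists_max fun i ↦ ‖ξ i‖
    exact ⟨i, le_antisymm ((pi_norm_le_iff_of_nonempty _).2 hi) (norm_le_pi_norm ξ i)⟩
  have key := VectorFourier.pow_mul_norm_iteratedFDeriv_fourierIntegral_le (dotCLM d)
    (μ := volume) (K := 0) (N := ⊤) (f := u) (by exact_mod_cast hu)
    (by
      intro k m hk _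
      have : k = 0 := Nat.le_zero.1 (by exact_mod_cast hk)
      subst this
      simpa using hint m)
    (k := 0) (n := n) le_rfl le_top (Pi.single i 1) ((2 * Real.pi)⁻¹ • ξ)
  rw [norm_iteratedFDeriv_zero, ← oscInt_eq_fourierIntegral] at key
  have hL : dotCLM d (Pi.single i 1) ((2 * Real.pi)⁻¹ • ξ) = (2 * Real.pi)⁻¹ * ξ i := by
    simp [dotCLM_apply, Pi.single_apply]
  have hpi := Real.pi_pos
  have hsingle : ‖(Pi.single i 1 : Fin d → ℝ)‖ = 1 := by rw [Pi.norm_single, norm_one]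
  rw [hL, abs_mul, abs_of_pos (by positivity), ← hi, hsingle] at key
  simp only [Finset.sum_product, zero_add, Finset.range_one, Finset.sum_singleton, pow_zero,
    one_mul, one_pow, Nat.cast_zero, mul_zero, mul_one] at key
  calc ‖ξ‖ ^ n * ‖oscInt u ξ‖
      = (2 * Real.pi) ^ n * (((2 * Real.pi)⁻¹ * ‖ξ‖) ^ n * ‖oscInt u ξ‖) := by
        rw [← mul_assoc, ← mul_pow, mul_inv_cancel_left₀ (by positivity)]
    _ ≤ (2 * Real.pi) ^ n * (2 ^ n *
        ∑ p ∈ Finset.range (n + 1), ∫ v, ‖iteratedFDeriv ℝ p u v‖) := by gcongr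
    _ = _ := by rw [← mul_assoc, ← mul_pow]; ring_nf

/-- Smooth functions all of whose iterated derivatives are bounded by prescribed constants. -/
def BoundedJets (d : ℕ) (M : ℕ → ℝ) : Set ((Fin d → ℝ) → ℂ) :=
  {φ | ContDiff ℝ (⊤ : ℕ∞) φ ∧ ∀ n y, ‖iteratedFDeriv ℝ n φ y‖ ≤ M n}

lemma norm_le_of_mem_boundedJets {d : ℕ} {M : ℕ → ℝ} {φ : (Fin d → ℝ) → ℂ}
    (hφ : φ ∈ BoundedJets d M) (y : Fin d → ℝ) : ‖φ y‖ ≤ M 0 := by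
  simpa using hφ.2 0 y

lemma boundedJets_comp_smul {d : ℕ} {M : ℕ → ℝ} {φ : (Fin d → ℝ) → ℂ}
    (hφ : φ ∈ BoundedJets d M) {t : ℝ} (ht0 : 0 ≤ t) (ht1 : t ≤ 1) :
    (fun y ↦ φ (t • y)) ∈ BoundedJets d M := by
  refine ⟨hφ.1.comp (contDiff_const_smul t), fun n y ↦ ?_⟩
  rw [iteratedFDeriv_comp_const_smul t (hφ.1.of_le (by exact_mod_cast le_top)),
    norm_smul, Real.norm_of_nonneg (by positivity)]
  exact (mul_le_of_le_one_left (norm_nonneg _) (pow_le_one₀ ht0 ht1)).trans (hφ.2 n _)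

lemma exists_pow_mul_norm_oscInt_mul_le {d : ℕ} {G : (Fin d → ℝ) → ℂ}
    (hG : ContDiff ℝ (⊤ : ℕ∞) G) (hsupp : HasCompactSupport G) (M : ℕ → ℝ) (n : ℕ) :
    ∃ C, ∀ φ ∈ BoundedJets d M, ∀ ξ, ‖ξ‖ ^ n * ‖oscInt (fun y ↦ G y * φ y) ξ‖ ≤ C := by
  refine ⟨(4 * Real.pi) ^ n * ∑ p ∈ Finset.range (n + 1), ∫ v,
    ∑ i ∈ Finset.range (p + 1), (p.choose i : ℝ) * ‖iteratedFDeriv ℝ i G v‖ * M (p - i),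
    fun φ hφ ξ ↦ ?_⟩
  refine (pow_mul_norm_oscInt_le (hG.mul hφ.1) hsupp.mul_right n ξ).trans ?_
  refine mul_le_mul_of_nonneg_left (Finset.sum_le_sum fun p hp ↦ ?_)
    (pow_nonneg (by linarith [Real.pi_pos]) n)
  refine integral_mono_of_nonneg (.of_forall fun v ↦ norm_nonneg _) ?_ (.of_forall fun v ↦ ?_)
  · refine integrable_finsetSum _ fun i _ ↦ Integrable.mul_const (Integrable.const_mul ?_ _) _
    exact ((hG.continuous_iteratedFDeriv
      (by exact_mod_cast le_top)).integrable_of_hasCompactSupport (hsupp.iteratedFDeriv i)).norm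
  · refine (norm_iteratedFDeriv_mul_le hG hφ.1 v (by exact_mod_cast le_top)).trans ?_
    dsimp only
    gcongr with i hi
    exact hφ.2 _ v

section Homogeneous

variable {d : ℕ} {κ : ℝ} {h : (Fin d → ℝ) → ℂ}

lemma exists_norm_le_of_homogeneous (h_cont : ContinuousOn h {x | x ≠ 0})
    (h_homog : ∀ x : Fin d → ℝ, x ≠ 0 → ∀ lam : ℝ, 0 < lam →
      h (lam • x) = ((lam ^ κ : ℝ) : ℂ) * h x) :
    ∃ C, 0 ≤ C ∧ ∀ y, y ≠ 0 → ‖h y‖ ≤ C * ‖y‖ ^ κ := by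
  obtain ⟨C, hC⟩ := (isCompact_sphere (0 : Fin d → ℝ) 1).exists_bound_of_continuousOn
    (h_cont.mono fun y hy ↦ by
      have : ‖y‖ = 1 := by simpa using hy
      exact norm_pos_iff.1 (by rw [this]; exact one_pos))
  refine ⟨|C|, abs_nonneg C, fun y hy ↦ ?_⟩
  have hy' : 0 < ‖y‖ := norm_pos_iff.2 hy
  have h1 : ‖‖y‖⁻¹ • y‖ = 1 := by
    rw [norm_smul, norm_inv, norm_norm, inv_mul_cancel₀ hy'.ne']
  have h2 := h_homog (‖y‖⁻¹ • y) (norm_pos_iff.1 (by rw [h1]; exact one_pos)) ‖y‖ hy'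
  rw [smul_inv_smul₀ hy'.ne'] at h2
  rw [h2, norm_mul, Complex.norm_real, Real.norm_of_nonneg (by positivity), mul_comm]
  gcongr
  exact (hC _ (by simpa using h1)).trans (le_abs_self C)

lemma measurable_of_continuousOn_ne_zero (h_cont : ContinuousOn h {x | x ≠ 0}) :
    Measurable h :=
  measurable_of_measurable_on_compl_singleton 0 h_cont.domRestrict.measurable

lemma integrable_homogeneous_mul (hκ : 0 < κ) (h_cont : ContinuousOn h {x | x ≠ 0})
    (h_homog : ∀ x : Fin d → ℝ, x ≠ 0 → ∀ lam : ℝ, 0 < lam →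
      h (lam • x) = ((lam ^ κ : ℝ) : ℂ) * h x)
    {u : (Fin d → ℝ) → ℂ} (hu : Continuous u) (hsupp : HasCompactSupport u) :
    Integrable (fun y ↦ h y * u y) := by
  obtain ⟨C, hC0, hC⟩ := exists_norm_le_of_homogeneous h_cont h_homog
  have hdom : Integrable (fun y : Fin d → ℝ ↦ (C * ‖y‖ ^ κ + ‖h 0‖) * ‖u y‖) := by
    refine Continuous.integrable_of_hasCompactSupport ?_ hsupp.norm.mul_left
    exact ((continuous_const.mul (continuous_norm.rpow_const fun _ ↦ .inr hκ.le)).add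
      continuous_const).mul hu.norm
  refine hdom.mono' ((measurable_of_continuousOn_ne_zero h_cont).aestronglyMeasurable.mul
    hu.aestronglyMeasurable) (.of_forall fun y ↦ ?_)
  rw [norm_mul]
  gcongr
  rcases eq_or_ne y 0 with rfl | hy
  · have : 0 ≤ C * ‖(0 : Fin d → ℝ)‖ ^ κ := by positivity
    linarith
  · linarith [hC y hy, norm_nonneg (h 0)]

lemma contDiff_mul_of_eventuallyEq_zero (h_smooth : ContDiffOn ℝ (⊤ : ℕ∞) h {x | x ≠ 0})
    {w : (Fin d → ℝ) → ℂ} (hw : ContDiff ℝ (⊤ : ℕ∞) w) (hw0 : w =ᶠ[nhds 0] 0) :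
    ContDiff ℝ (⊤ : ℕ∞) (fun y ↦ h y * w y) := by
  rw [contDiff_iff_contDiffAt]
  intro y
  rcases eq_or_ne y 0 with rfl | hy
  · refine (contDiffAt_const (c := (0 : ℂ))).congr_of_eventuallyEq ?_
    filter_upwards [hw0] with y hy
    simp [hy]
  · exact (h_smooth.contDiffAt (isOpen_ne.mem_nhds hy)).mul hw.contDiffAt

lemma oscInt_rescale [Nonempty (Fin d)]
    (h_homog : ∀ x : Fin d → ℝ, x ≠ 0 → ∀ lam : ℝ, 0 < lam →
      h (lam • x) = ((lam ^ κ : ℝ) : ℂ) * h x) (u φ : (Fin d → ℝ) → ℂ) (ξ : Fin d → ℝ) :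
    oscInt (fun y ↦ h y * u ((2 : ℝ) • y) * φ y) ξ = (((2 : ℝ) ^ (-(κ + d)) : ℝ) : ℂ) *
      oscInt (fun y ↦ h y * u y * φ ((1 / 2 : ℝ) • y)) ((1 / 2 : ℝ) • ξ) := by
  have hscale := Measure.integral_comp_smul (volume : Measure (Fin d → ℝ))
    (fun y ↦ Complex.exp (-(Complex.I * ((∑ i, ((1 / 2 : ℝ) • ξ) i * y i : ℝ) : ℂ))) *
      (h y * u y * φ ((1 / 2 : ℝ) • y))) 2
  have hae : ∀ᵐ y : Fin d → ℝ, Complex.exp (-(Complex.I *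
      ((∑ i, ((1 / 2 : ℝ) • ξ) i * ((2 : ℝ) • y) i : ℝ) : ℂ))) *
      (h ((2 : ℝ) • y) * u ((2 : ℝ) • y) * φ ((1 / 2 : ℝ) • (2 : ℝ) • y)) =
      (((2 : ℝ) ^ κ : ℝ) : ℂ) * (Complex.exp (-(Complex.I * ((∑ i, ξ i * y i : ℝ) : ℂ))) *
      (h y * u ((2 : ℝ) • y) * φ y)) := by
    have : ∀ᵐ y : Fin d → ℝ, y ≠ 0 := by simp [ae_iff]
    filter_upwards [this] with y hy
    have hsum : ∑ i, ((1 / 2 : ℝ) • ξ) i * ((2 : ℝ) • y) i = ∑ i, ξ i * y i :=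
      Finset.sum_congr rfl fun i _ ↦ by simp only [Pi.smul_apply, smul_eq_mul]; ring
    rw [h_homog y hy 2 two_pos, smul_smul, hsum]
    norm_num
    ring
  rw [integral_congr_ae hae, integral_const_mul] at hscale
  have h2 : (((2 : ℝ) ^ κ : ℝ) : ℂ) ≠ 0 := by
    exact_mod_cast (Real.rpow_pos_of_pos two_pos κ).ne'
  unfold oscInt
  rw [← mul_right_inj' h2, hscale, ← mul_assoc, ← Complex.ofReal_mul,
    ← Real.rpow_add two_pos, Complex.real_smul]
  congr 2
  rw [Module.finrank_fin_fun, abs_of_nonneg (by positivity), ← Real.rpow_natCast,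
    ← Real.rpow_neg zero_le_two]
  congr 1
  ring

/-- Decay of `∫ h u φ e^{-i ξ·y}` for homogeneous `h` and a cutoff `u` equal to one near the origin,
uniformly over amplitudes `φ` with uniformly bounded derivatives. -/
lemma exists_norm_oscInt_homogeneous_le (hκ : 0 < κ)
    (h_smooth : ContDiffOn ℝ (⊤ : ℕ∞) h {x | x ≠ 0})
    (h_homog : ∀ x : Fin d → ℝ, x ≠ 0 → ∀ lam : ℝ, 0 < lam →
      h (lam • x) = ((lam ^ κ : ℝ) : ℂ) * h x)
    {u : (Fin d → ℝ) → ℂ} (hu : ContDiff ℝ (⊤ : ℕ∞) u) (hsupp : HasCompactSupport u)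
    (hu1 : u =ᶠ[nhds 0] 1) (M : ℕ → ℝ) :
    ∃ D > 0, ∀ φ ∈ BoundedJets d M, ∀ ξ,
      ‖oscInt (fun y ↦ h y * u y * φ y) ξ‖ ≤ D * (1 + ‖ξ‖) ^ (-(κ + d)) := by
  have h_cont := h_smooth.continuousOn
  have hu2 : ContDiff ℝ (⊤ : ℕ∞) (fun y ↦ u ((2 : ℝ) • y)) := hu.comp (contDiff_const_smul 2)
  have hsupp2 : HasCompactSupport (fun y ↦ u ((2 : ℝ) • y)) := hsupp.comp_smul two_ne_zero
  have hi1 := integrable_homogeneous_mul hκ h_cont h_homog hu.continuous hsupp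
  have hi2 := integrable_homogeneous_mul hκ h_cont h_homog hu2.continuous hsupp2
  have hw0 : (fun y ↦ u y - u ((2 : ℝ) • y)) =ᶠ[nhds 0] 0 := by
    have ht : Filter.Tendsto (fun y : Fin d → ℝ ↦ (2 : ℝ) • y) (nhds 0) (nhds 0) := by
      simpa using (continuous_const_smul (2 : ℝ)).tendsto (0 : Fin d → ℝ)
    filter_upwards [hu1, ht.eventually hu1] with y h1 h2
    simp [h1, h2]
  have hG := contDiff_mul_of_eventuallyEq_zero h_smooth (hu.sub hu2) hw0
  have hGsupp : HasCompactSupport (fun y ↦ h y * (u y - u ((2 : ℝ) • y))) :=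
    (hsupp.sub hsupp2).mul_left
  obtain ⟨N, hN⟩ := exists_nat_gt (κ + d)
  obtain ⟨C, hC⟩ := exists_pow_mul_norm_oscInt_mul_le hG hGsupp M N
  suffices hdecay : ∃ D > 0, ∀ (φ : BoundedJets d M) (ξ : Fin d → ℝ),
      ‖oscInt (fun y ↦ h y * u y * φ.1 y) ξ‖ ≤ D * (1 + ‖ξ‖) ^ (-(κ + d)) by
    obtain ⟨D, hD0, hD⟩ := hdecay
    exact ⟨D, hD0, fun φ hφ ξ ↦ hD ⟨φ, hφ⟩ ξ⟩
  refine decay_of_dyadic_recursion (ι := BoundedJets d M) (E := Fin d → ℝ)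
    (fun φ ξ ↦ ‖oscInt (fun y ↦ h y * u y * φ.1 y) ξ‖)
    (fun φ ↦ ⟨_, boundedJets_comp_smul φ.2 (t := 1 / 2) (by norm_num) (by norm_num)⟩)
    (A := (∫ y, ‖h y * u y‖ * M 0)) (C := C) (by positivity : 0 < κ + d) hN
    (fun φ ξ ↦ ?_) (fun φ ξ hξ ↦ ?_)
  · refine (norm_oscInt_le _ ξ).trans (integral_mono_of_nonneg
      (Filter.Eventually.of_forall fun y ↦ norm_nonneg (h y * u y * φ.1 y))
      (hi1.norm.mul_const _) (Filter.Eventually.of_forall fun y ↦ ?_))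
    dsimp only
    rw [norm_mul]
    gcongr
    exact norm_le_of_mem_boundedJets φ.2 y
  · have hξ0 : 0 < ‖ξ‖ := by linarith
    have : Nonempty (Fin d) := by
      by_contra hne
      rw [not_nonempty_iff] at hne
      simp [Subsingleton.elim ξ 0] at hξ0
    have hint : ∀ v : (Fin d → ℝ) → ℂ, Integrable v →
        Integrable (fun y ↦ Complex.exp (-(Complex.I * ((∑ i, ξ i * y i : ℝ) : ℂ))) *
          (v y * φ.1 y)) := fun v hv ↦ by
      refine (hv.mul_bdd (c := M 0) φ.2.1.continuous.aestronglyMeasurable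
        (.of_forall (norm_le_of_mem_boundedJets φ.2))).bdd_mul (c := 1) ?_
        (.of_forall fun y ↦ (norm_exp_neg_I_mul _).le)
      exact Continuous.aestronglyMeasurable (by fun_prop)
    have hsplit : oscInt (fun y ↦ h y * u y * φ.1 y) ξ =
        oscInt (fun y ↦ h y * (u y - u ((2 : ℝ) • y)) * φ.1 y) ξ +
          oscInt (fun y ↦ h y * u ((2 : ℝ) • y) * φ.1 y) ξ := by
      unfold oscInt
      rw [← integral_add (hint _ ((hi1.sub hi2).congr (.of_forall fun y ↦ by
        simp only [Pi.sub_apply]; ring))) (hint _ hi2)]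
      congr 1 with y
      ring
    dsimp only
    rw [hsplit]
    refine (norm_add_le _ _).trans (add_le_add ?_ ?_)
    · rw [Real.rpow_neg hξ0.le, Real.rpow_natCast, ← div_eq_mul_inv, le_div_iff₀' (by positivity)]
      exact hC φ.1 φ.2 ξ
    · rw [oscInt_rescale h_homog, norm_mul, Complex.norm_real,
        Real.norm_of_nonneg (by positivity)]

end Homogeneous

lemma norm_stft_eq_norm_oscInt {d : ℕ} (g f : (Fin d → ℝ) → ℂ) (x ξ : Fin d → ℝ) :
    ‖stft g f (x, ξ)‖ = ‖oscInt (fun y ↦ f y * starRingEnd ℂ (g (y - x))) ξ‖ := by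
  have : stft g f (x, ξ) = Complex.exp (Complex.I * ((∑ i, ξ i * x i : ℝ) : ℂ)) *
      oscInt (fun y ↦ f y * starRingEnd ℂ (g (y - x))) ξ := by
    unfold stft oscInt tfshift
    rw [← integral_const_mul]
    congr 1 with y
    rw [map_mul, ← Complex.exp_conj, map_mul, Complex.conj_I, Complex.conj_ofReal, mul_left_comm,
      ← mul_assoc (Complex.exp _) (Complex.exp _), ← Complex.exp_add]
    congr 2
    simp only [Pi.sub_apply, mul_sub, Finset.sum_sub_distrib, Complex.ofReal_sub]
    ring
  rw [this, norm_mul, mul_comm Complex.I, Complex.norm_exp_ofReal_mul_I, one_mul]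

lemma exists_mul_conj_translate_mem_boundedJets {d : ℕ} {χ : (Fin d → ℝ) → ℂ}
    (hχ_smooth : ContDiff ℝ (⊤ : ℕ∞) χ) (hχ_supp : HasCompactSupport χ)
    (g : SchwartzMap (Fin d → ℝ) ℂ) :
    ∃ M : ℕ → ℝ, ∀ x, (fun y ↦ χ y * starRingEnd ℂ (g (y - x))) ∈ BoundedJets d M := by
  have hχ_bdd : ∀ n : ℕ, ∃ C, ∀ y, ‖iteratedFDeriv ℝ n χ y‖ ≤ C := fun n ↦
    (hχ_supp.iteratedFDeriv n).exists_bound_of_continuous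
      (hχ_smooth.continuous_iteratedFDeriv (by exact_mod_cast le_top))
  choose A hA using hχ_bdd
  have hg_bdd : ∀ n : ℕ, ∃ C, ∀ y, ‖iteratedFDeriv ℝ n g y‖ ≤ C := fun n ↦ by
    obtain ⟨C, -, hC⟩ := g.decay 0 n
    exact ⟨C, fun y ↦ by simpa using hC y⟩
  choose B hB using hg_bdd
  refine ⟨fun n ↦ ∑ i ∈ Finset.range (n + 1), (n.choose i : ℝ) * A i * B (n - i), fun x ↦ ?_⟩
  have htrans : ContDiff ℝ (⊤ : ℕ∞) (fun y ↦ g (y - x)) :=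
    (g.smooth _).comp (contDiff_id.sub contDiff_const)
  have hconj : ContDiff ℝ (⊤ : ℕ∞) (fun y ↦ starRingEnd ℂ (g (y - x))) :=
    Complex.conjLIE.contDiff.comp htrans
  have hconj_bdd : ∀ n y, ‖iteratedFDeriv ℝ n (fun y ↦ starRingEnd ℂ (g (y - x))) y‖ ≤ B n := by
    intro n y
    have := Complex.conjLIE.norm_iteratedFDeriv_comp_left (𝕜 := ℝ) (fun y ↦ g (y - x)) y n
    rw [iteratedFDeriv_comp_sub] at this
    exact this.trans_le (hB n _)
  refine ⟨hχ_smooth.mul hconj, fun n y ↦ ?_⟩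
  refine (norm_iteratedFDeriv_mul_le hχ_smooth hconj y (by exact_mod_cast le_top)).trans ?_
  have hA0 : ∀ i, 0 ≤ A i := fun i ↦ (norm_nonneg _).trans (hA i 0)
  refine Finset.sum_le_sum fun i _ ↦ mul_le_mul ?_ (hconj_bdd _ y) (norm_nonneg _)
    (mul_nonneg (Nat.cast_nonneg _) (hA0 i))
  exact mul_le_mul_of_nonneg_left (hA i y) (Nat.cast_nonneg _)

/-- If `h` is smooth away from the origin and positively homogeneous of degree
`κ > 0`, and `χ` is a smooth compactly supported cutoff, then the STFT of
`f = hχ` satisfies `|V_g f(x,ξ)| ≤ C (1+|ξ|)^{-κ-d}`. -/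
theorem stft_homogeneous_cutoff_decay {d : ℕ} (κ : ℝ) (hκ : 0 < κ)
    (h : (Fin d → ℝ) → ℂ)
    (h_smooth : ContDiffOn ℝ (⊤ : ℕ∞) h {x | x ≠ 0})
    (h_homog : ∀ x : Fin d → ℝ, x ≠ 0 → ∀ lam : ℝ, 0 < lam →
      h (lam • x) = ((lam ^ κ : ℝ) : ℂ) * h x)
    (χ : (Fin d → ℝ) → ℂ) (hχ_smooth : ContDiff ℝ (⊤ : ℕ∞) χ)
    (hχ_supp : HasCompactSupport χ)
    (g : SchwartzMap (Fin d → ℝ) ℂ) :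
    ∃ C > 0, ∀ x ξ : Fin d → ℝ,
      ‖stft (fun t => g t) (fun y => h y * χ y) (x, ξ)‖ ≤
        C * (1 + ‖ξ‖) ^ (-(κ + d)) := by
  obtain ⟨R, hR0, hR⟩ := hχ_supp.isCompact.isBounded.subset_closedBall_lt 0 (0 : Fin d → ℝ)
  let ρ : ContDiffBump (0 : Fin d → ℝ) := ⟨R, R + 1, hR0, by linarith⟩
  obtain ⟨M, hM⟩ := exists_mul_conj_translate_mem_boundedJets hχ_smooth hχ_supp g
  have hρ_smooth : ContDiff ℝ (⊤ : ℕ∞) (fun y ↦ (ρ y : ℂ)) :=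
    Complex.ofRealCLM.contDiff.comp ρ.contDiff
  have hρ_supp : HasCompactSupport (fun y ↦ (ρ y : ℂ)) :=
    ρ.hasCompactSupport.comp_left Complex.ofReal_zero
  have hρ_one : (fun y ↦ (ρ y : ℂ)) =ᶠ[nhds 0] 1 := by
    filter_upwards [ρ.eventuallyEq_one] with y hy
    simp [hy]
  obtain ⟨D, hD0, hD⟩ :=
    exists_norm_oscInt_homogeneous_le hκ h_smooth h_homog hρ_smooth hρ_supp hρ_one M
  refine ⟨D, hD0, fun x ξ ↦ ?_⟩
  rw [norm_stft_eq_norm_oscInt]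
  refine (le_of_eq ?_).trans (hD _ (hM x) ξ)
  congr 2 with y
  by_cases hy : y ∈ tsupport χ
  · have : ρ y = 1 := ρ.one_of_mem_closedBall (hR hy)
    rw [this]
    push_cast
    ring
  · simp [image_eq_zero_of_notMem_tsupport hy]
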